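/- arXiv:2309.13478 — 2 statements merged into one kernel-verified Lean document; each statement's English description precedes it below -/
import Mathlib

section
/- There exists a constant C > 0, depending only on d and D, such that for all symmetric d×d real matrices M_1, …, M_{D−d} with Λ = max_j ‖M_j‖ ≤ 1 and every unit vector θ* ∈ ℝ^d, one has ∫_R (x·θ*)² S(x) dx / ∫_R S(x) dx ≥ 1/(d+2) − (20d² + 82d + 76)·A/((d+2)³(d+4)) − (11d + 24)·B/(2(d+2)²(d+4)) − C Λ⁴. -/
open MeasureTheory Matrix Real

/-- First fundamental form of the graph of the quadratic embedding
`x ↦ (x, xᵀM₁x, …, xᵀM_{D-d}x)`. -/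
noncomputable def gMat {d m : ℕ} (M : Fin m → Matrix (Fin d) (Fin d) ℝ)
    (x : Fin d → ℝ) : Matrix (Fin d) (Fin d) ℝ :=
  1 + (4 : ℝ) • ∑ k, vecMulVec (M k *ᵥ x) (M k *ᵥ x)

/-- The density `S(x) = √(det g(x))`. -/
noncomputable def Sdens {d m : ℕ} (M : Fin m → Matrix (Fin d) (Fin d) ℝ)
    (x : Fin d → ℝ) : ℝ :=
  Real.sqrt (gMat M x).det

/-- The region `R = {x : ‖x‖² + Σⱼ Qⱼ(x)² ≤ 1}`, where `Qⱼ(x) = xᵀMⱼx`. -/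
def regionR {d m : ℕ} (M : Fin m → Matrix (Fin d) (Fin d) ℝ) : Set (Fin d → ℝ) :=
  {x | ∑ i, x i ^ 2 + ∑ j, (x ⬝ᵥ (M j *ᵥ x)) ^ 2 ≤ 1}

/-- `Λ`, the maximum of the operator norms of the matrices `M j`. -/
noncomputable def Lam {d m : ℕ} (M : Fin m → Matrix (Fin d) (Fin d) ℝ) : ℝ :=
  ⨆ j, ‖Matrix.toEuclideanCLM (𝕜 := ℝ) (M j)‖

/-- `A = Σⱼ tr(Mⱼ²)`. -/
noncomputable def Aconst {d m : ℕ} (M : Fin m → Matrix (Fin d) (Fin d) ℝ) : ℝ :=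
  ∑ j, (M j * M j).trace

/-- `B = Σⱼ (tr Mⱼ)²`. -/
noncomputable def Bconst {d m : ℕ} (M : Fin m → Matrix (Fin d) (Fin d) ℝ) : ℝ :=
  ∑ j, (M j).trace ^ 2

open scoped Pointwise in
theorem setIntegral_sublevel_eq_of_homogeneous {d k p : ℕ} (hp : 0 < p)
    {f G : (Fin d → ℝ) → ℝ}
    (hfh : ∀ c > 0, ∀ x, f (c • x) = c ^ k * f x) (hGh : ∀ c > 0, ∀ x, G (c • x) = c ^ p * G x)
    {τ : ℝ} (hτ : 0 < τ) :
    ∫ x in {x | G x ≤ τ}, f x = τ ^ (((d : ℝ) + k) / p) * ∫ x in {x | G x ≤ 1}, f x := by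
  set c : ℝ := τ ^ ((p : ℝ)⁻¹) with hc
  have hc0 : 0 < c := rpow_pos_of_pos hτ _
  have hcp : c ^ p = τ := rpow_inv_natCast_pow hτ.le hp.ne'
  have hset : {x : Fin d → ℝ | G x ≤ τ} = c • {x | G x ≤ 1} := by
    ext x
    rw [Set.mem_smul_set_iff_inv_smul_mem₀ hc0.ne']
    simp only [Set.mem_ofPred_eq]
    rw [hGh _ (inv_pos.2 hc0), inv_pow, hcp, inv_mul_le_one₀ hτ]
  have h := Measure.setIntegral_comp_smul_of_pos (volume : Measure (Fin d → ℝ)) f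
    {x | G x ≤ 1} hc0
  rw [← hset] at h
  simp only [hfh c hc0, integral_const_mul, Module.finrank_fin_fun, smul_eq_mul] at h
  have hpow : τ ^ (((d : ℝ) + k) / p) = c ^ d * c ^ k := by
    rw [← pow_add, ← rpow_natCast c, hc, ← rpow_mul hτ.le]
    congr 1
    push_cast
    ring
  rw [hpow, mul_assoc, h, mul_inv_cancel_left₀ (pow_pos hc0 d).ne']

theorem setIntegral_sublevel_mul_one_sub {d k p : ℕ} (hp : 0 < p)
    {f G : (Fin d → ℝ) → ℝ} (hf : Continuous f) (hG : Continuous G)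
    (hfh : ∀ c > 0, ∀ x, f (c • x) = c ^ k * f x) (hGh : ∀ c > 0, ∀ x, G (c • x) = c ^ p * G x)
    (hG0 : ∀ x, 0 ≤ G x) (hK : IsCompact {x | G x ≤ 1}) :
    ((d : ℝ) + k + p) * ∫ x in {x | G x ≤ 1}, f x * (1 - G x) =
      p * ∫ x in {x | G x ≤ 1}, f x := by
  set K : Set (Fin d → ℝ) := {x | G x ≤ 1} with hKdef
  have hlayer : ∀ x ∈ K, f x * (1 - G x) =
      ∫ τ in Set.Icc (0 : ℝ) 1, {q : (Fin d → ℝ) × ℝ | G q.1 ≤ q.2}.indicator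
        (fun q => f q.1) (x, τ) := by
    intro x hx
    have : ∀ τ : ℝ, {q : (Fin d → ℝ) × ℝ | G q.1 ≤ q.2}.indicator (fun q => f q.1) (x, τ) =
        (Set.Ici (G x)).indicator (fun _ => f x) τ := fun τ => by
      simp [Set.indicator]
    simp only [this]
    rw [integral_indicator_const _ measurableSet_Ici, measureReal_restrict_apply measurableSet_Ici,
      show Set.Ici (G x) ∩ Set.Icc (0 : ℝ) 1 = Set.Icc (G x) 1 by
        ext τ; simp only [Set.mem_inter_iff, Set.mem_Ici, Set.mem_Icc]
        exact ⟨fun h => ⟨h.1, h.2.2⟩, fun h => ⟨h.1, (hG0 x).trans h.1, h.2⟩⟩,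
      Real.volume_real_Icc_of_le hx, smul_eq_mul, mul_comm]
  have hKm : MeasurableSet K := hK.measurableSet
  have hint : Integrable (Function.uncurry fun x τ =>
      {q : (Fin d → ℝ) × ℝ | G q.1 ≤ q.2}.indicator (fun q => f q.1) (x, τ))
      ((volume.restrict K).prod (volume.restrict (Set.Icc (0 : ℝ) 1))) := by
    have h1 : Integrable f (volume.restrict K) := hf.continuousOn.integrableOn_compact hK
    exact (h1.comp_fst _).indicator
      (measurableSet_le (hG.measurable.comp measurable_fst) measurable_snd)
  have hn : (0 : ℝ) ≤ ((d : ℝ) + k) / p := by positivity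
  have hp' : (0 : ℝ) < p := by exact_mod_cast hp
  rw [setIntegral_congr_fun hKm hlayer, integral_integral_swap hint]
  have hinner : ∀ τ ∈ Set.Ioc (0 : ℝ) 1, (∫ x in K,
      {q : (Fin d → ℝ) × ℝ | G q.1 ≤ q.2}.indicator (fun q => f q.1) (x, τ)) =
      τ ^ (((d : ℝ) + k) / p) * ∫ x in K, f x := by
    intro τ hτ
    have : ∀ x, {q : (Fin d → ℝ) × ℝ | G q.1 ≤ q.2}.indicator (fun q => f q.1) (x, τ) =
        {x | G x ≤ τ}.indicator f x := fun x => by simp [Set.indicator]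
    simp only [this]
    rw [setIntegral_indicator (measurableSet_le hG.measurable measurable_const),
      ← setIntegral_sublevel_eq_of_homogeneous hp hfh hGh hτ.1]
    congr 2
    ext x
    exact ⟨fun h => h.2, fun h => ⟨le_trans h hτ.2, h⟩⟩
  rw [integral_Icc_eq_integral_Ioc, setIntegral_congr_fun measurableSet_Ioc hinner,
    integral_mul_const, ← intervalIntegral.integral_of_le zero_le_one,
    integral_rpow (Or.inl (by linarith)), one_rpow, zero_rpow (by linarith)]
  field_simp
  ring

theorem isCompact_dotProduct_self_le_one (d : ℕ) : IsCompact {x : Fin d → ℝ | x ⬝ᵥ x ≤ 1} := by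
  refine (isCompact_closedBall (0 : Fin d → ℝ) 1).of_isClosed_subset
    (isClosed_le (by fun_prop) continuous_const) fun x hx => ?_
  rw [mem_closedBall_zero_iff, pi_norm_le_iff_of_nonneg zero_le_one]
  intro i
  have : x i * x i ≤ x ⬝ᵥ x :=
    Finset.single_le_sum (f := fun i => x i * x i) (fun j _ => mul_self_nonneg _)
      (Finset.mem_univ i)
  rw [Real.norm_eq_abs, abs_le_one_iff_mul_self_le_one]
  exact this.trans hx

theorem hasDerivAt_max_zero_sq (y : ℝ) :
    HasDerivAt (fun y : ℝ => max 0 y ^ 2) (2 * max 0 y) y := by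
  rcases lt_trichotomy y 0 with h | rfl | h
  · rw [max_eq_left h.le, mul_zero]
    refine (hasDerivAt_const y (0 : ℝ)).congr_of_eventuallyEq ?_
    filter_upwards [gt_mem_nhds h] with z hz
    simp [max_eq_left hz.le]
  · rw [max_self, mul_zero]
    have h0 : HasDerivAt (fun y : ℝ => y ^ 2) 0 0 := by simpa using hasDerivAt_pow 2 (0 : ℝ)
    rw [hasDerivAt_iff_isLittleO] at h0 ⊢
    refine (Asymptotics.IsBigO.of_norm_le fun z => ?_).trans_isLittleO h0
    rcases le_total z 0 with hz | hz
    · simp [max_eq_left hz, sq_nonneg]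
    · simp [max_eq_right hz]
  · rw [max_eq_right h.le]
    have h0 : HasDerivAt (fun y : ℝ => y ^ 2) (2 * y) y := by simpa using hasDerivAt_pow 2 y
    refine h0.congr_of_eventuallyEq ?_
    filter_upwards [lt_mem_nhds h] with z hz
    simp [max_eq_right hz.le]

theorem integrable_of_eq_zero_of_one_lt {d : ℕ} {f : (Fin d → ℝ) → ℝ} (hf : Continuous f)
    (h : ∀ x, 1 < x ⬝ᵥ x → f x = 0) : Integrable f :=
  hf.integrable_of_hasCompactSupport
    (HasCompactSupport.intro (isCompact_dotProduct_self_le_one d) fun x hx => h x (not_le.1 hx))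

theorem integrableOn_dotProduct_self_le_one {d : ℕ} {f : (Fin d → ℝ) → ℝ} (hf : Continuous f) :
    IntegrableOn f {x | x ⬝ᵥ x ≤ 1} :=
  hf.continuousOn.integrableOn_compact (isCompact_dotProduct_self_le_one d)

theorem hasDerivAt_dotProduct_add_smul {d : ℕ} (w x v : Fin d → ℝ) (t : ℝ) :
    HasDerivAt (fun t : ℝ => w ⬝ᵥ (x + t • v)) (w ⬝ᵥ v) t := by
  simp only [dotProduct_add, dotProduct_smul, smul_eq_mul]
  simpa using ((hasDerivAt_id t).mul_const (w ⬝ᵥ v)).const_add (w ⬝ᵥ x)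

theorem hasDerivAt_quadratic_add_smul {d : ℕ} {M : Matrix (Fin d) (Fin d) ℝ} (hM : M.IsSymm)
    (x v : Fin d → ℝ) :
    HasDerivAt (fun t : ℝ => (x + t • v) ⬝ᵥ (M *ᵥ (x + t • v))) (2 * (v ⬝ᵥ (M *ᵥ x))) 0 := by
  have hsymm : x ⬝ᵥ (M *ᵥ v) = v ⬝ᵥ (M *ᵥ x) := by
    rw [dotProduct_mulVec, dotProduct_comm, ← mulVec_transpose, hM.eq]
  have h : ∀ t : ℝ, (x + t • v) ⬝ᵥ (M *ᵥ (x + t • v)) =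
      x ⬝ᵥ (M *ᵥ x) + t * (2 * (v ⬝ᵥ (M *ᵥ x))) + t ^ 2 * (v ⬝ᵥ (M *ᵥ v)) := fun t => by
    simp only [mulVec_add, mulVec_smul, dotProduct_add, add_dotProduct, dotProduct_smul,
      smul_dotProduct, smul_eq_mul, hsymm]
    ring
  simp only [h]
  simpa using (((hasDerivAt_id (0 : ℝ)).mul_const (2 * (v ⬝ᵥ (M *ᵥ x)))).const_add
    (x ⬝ᵥ (M *ᵥ x))).fun_add ((hasDerivAt_pow 2 (0 : ℝ)).mul_const (v ⬝ᵥ (M *ᵥ v)))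

/-- Integration by parts on the unit ball against homogeneous functions. -/
theorem setIntegral_ball_dotProduct_mul {d k : ℕ} (v : Fin d → ℝ) {p p' : (Fin d → ℝ) → ℝ}
    (hp : Continuous p) (hp' : Continuous p')
    (hder : ∀ x, HasDerivAt (fun t : ℝ => p (x + t • v)) (p' x) 0)
    (hph : ∀ c > 0, ∀ x, p (c • x) = c ^ (k + 1) * p x)
    (hph' : ∀ c > 0, ∀ x, p' (c • x) = c ^ k * p' x) :
    ((d : ℝ) + k + 2) * ∫ x in {x | x ⬝ᵥ x ≤ 1}, (v ⬝ᵥ x) * p x =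
      ∫ x in {x | x ⬝ᵥ x ≤ 1}, p' x := by
  have hrc : Continuous fun x : Fin d → ℝ => x ⬝ᵥ x := by fun_prop
  have hrh : ∀ c > (0 : ℝ), ∀ x : Fin d → ℝ, (c • x) ⬝ᵥ (c • x) = c ^ 2 * (x ⬝ᵥ x) :=
    fun c _ x => by simp only [smul_dotProduct, dotProduct_smul, smul_eq_mul]; ring
  have hr0 : ∀ x : Fin d → ℝ, 0 ≤ x ⬝ᵥ x := fun x =>
    Finset.sum_nonneg fun i _ => mul_self_nonneg _
  have hB := isCompact_dotProduct_self_le_one d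
  have h1 := setIntegral_sublevel_mul_one_sub (k := k) two_pos hp' hrc hph' hrh hr0 hB
  have h2 := setIntegral_sublevel_mul_one_sub (k := k + 2) (f := fun x => p' x * (x ⬝ᵥ x)) two_pos
    (by fun_prop) hrc (fun c hc x => by rw [hph' c hc, hrh c hc]; ring) hrh hr0 hB
  have h3 := setIntegral_sublevel_mul_one_sub (k := k + 2) (f := fun x => (v ⬝ᵥ x) * p x) two_pos
    (by fun_prop) hrc (fun c hc x => by
      rw [hph c hc, dotProduct_smul, smul_eq_mul]; ring) hrh hr0 hB
  have hz : ∀ x : Fin d → ℝ, 1 < x ⬝ᵥ x → max 0 (1 - x ⬝ᵥ x) = 0 := fun x hx =>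
    max_eq_left (by linarith)
  have hWder : ∀ x, HasDerivAt (fun t : ℝ => max 0 (1 - (x + t • v) ⬝ᵥ (x + t • v)) ^ 2)
      (2 * max 0 (1 - x ⬝ᵥ x) * -(2 * (v ⬝ᵥ x))) 0 := by
    intro x
    have hq := hasDerivAt_quadratic_add_smul (M := 1) isSymm_one x v
    simp only [one_mulVec] at hq
    refine HasDerivAt.comp (h₂ := fun y : ℝ => max 0 y ^ 2) 0 ?_ (hq.const_sub 1)
    simpa using hasDerivAt_max_zero_sq (1 - x ⬝ᵥ x)
  have hibp := integral_bilinear_hasLineDerivAt_right_eq_neg_left_of_integrable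
    (μ := (volume : Measure (Fin d → ℝ))) (v := v) (B := ContinuousLinearMap.mul ℝ ℝ)
    (f := fun x => max 0 (1 - x ⬝ᵥ x) ^ 2)
    (f' := fun x => 2 * max 0 (1 - x ⬝ᵥ x) * -(2 * (v ⬝ᵥ x))) (g := p) (g' := p')
    (integrable_of_eq_zero_of_one_lt (by simp only [ContinuousLinearMap.mul_apply']; fun_prop)
      fun x hx => by simp [hz x hx])
    (integrable_of_eq_zero_of_one_lt (by simp only [ContinuousLinearMap.mul_apply']; fun_prop)
      fun x hx => by simp [hz x hx])
    (integrable_of_eq_zero_of_one_lt (by simp only [ContinuousLinearMap.mul_apply']; fun_prop)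
      fun x hx => by simp [hz x hx])
    (fun x _ => hWder x) (fun x _ => hder x)
  simp only [ContinuousLinearMap.mul_apply'] at hibp
  rw [← setIntegral_eq_integral_of_forall_compl_eq_zero (s := {x : Fin d → ℝ | x ⬝ᵥ x ≤ 1})
      (fun x hx => by simp [hz x (not_le.1 hx)]),
    ← setIntegral_eq_integral_of_forall_compl_eq_zero (s := {x : Fin d → ℝ | x ⬝ᵥ x ≤ 1})
      (f := fun x => 2 * max 0 (1 - x ⬝ᵥ x) * -(2 * (v ⬝ᵥ x)) * p x)
      (fun x hx => by simp [hz x (not_le.1 hx)]),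
    setIntegral_congr_fun (g := fun x => p' x * (1 - x ⬝ᵥ x) - p' x * (x ⬝ᵥ x) * (1 - x ⬝ᵥ x))
      hB.measurableSet (fun x hx => by
        have : 0 ≤ 1 - x ⬝ᵥ x := sub_nonneg.2 hx
        simp only [max_eq_right this]; ring),
    setIntegral_congr_fun (g := fun x => -4 * ((v ⬝ᵥ x) * p x * (1 - x ⬝ᵥ x)))
      (f := fun x => 2 * max 0 (1 - x ⬝ᵥ x) * -(2 * (v ⬝ᵥ x)) * p x)
      hB.measurableSet (fun x hx => by
        have : 0 ≤ 1 - x ⬝ᵥ x := sub_nonneg.2 hx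
        simp only [max_eq_right this]; ring),
    integral_sub (integrableOn_dotProduct_self_le_one (by fun_prop))
      (integrableOn_dotProduct_self_le_one (by fun_prop)), integral_const_mul] at hibp
  have h4 : ∫ x in {x : Fin d → ℝ | x ⬝ᵥ x ≤ 1}, p' x * (1 - x ⬝ᵥ x) =
      (∫ x in {x : Fin d → ℝ | x ⬝ᵥ x ≤ 1}, p' x) -
        ∫ x in {x : Fin d → ℝ | x ⬝ᵥ x ≤ 1}, p' x * (x ⬝ᵥ x) := by
    rw [← integral_sub (integrableOn_dotProduct_self_le_one (by fun_prop))
      (integrableOn_dotProduct_self_le_one (by fun_prop))]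
    simp only [mul_sub, mul_one]
  push_cast at h1 h2 h3
  linear_combination -((d : ℝ) + k + 2) / 2 * h3 - ((d : ℝ) + k + 2) * (d + k + 4) / 8 * hibp +
    (((d : ℝ) + k + 4) / 8 + 1 / 4) * h1 - ((d : ℝ) + k + 2) / 8 * h2 - ((d : ℝ) + k + 2) / 4 * h4

theorem setIntegral_ball_dotProduct_mul_dotProduct {d : ℕ} (v w : Fin d → ℝ) :
    ((d : ℝ) + 2) * ∫ x in {x : Fin d → ℝ | x ⬝ᵥ x ≤ 1}, (v ⬝ᵥ x) * (w ⬝ᵥ x) =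
      (v ⬝ᵥ w) * volume.real {x : Fin d → ℝ | x ⬝ᵥ x ≤ 1} := by
  have h := setIntegral_ball_dotProduct_mul (k := 0) v (p := fun x => w ⬝ᵥ x)
    (p' := fun _ => w ⬝ᵥ v) (by fun_prop) continuous_const
    (fun x => hasDerivAt_dotProduct_add_smul w x v 0)
    (fun c _ x => by simp) (fun c _ x => by simp)
  simp only [setIntegral_const, smul_eq_mul, Nat.cast_zero, add_zero] at h
  rw [h, dotProduct_comm w v, mul_comm]

theorem setIntegral_ball_quadratic {d : ℕ} (M : Matrix (Fin d) (Fin d) ℝ) :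
    ((d : ℝ) + 2) * ∫ x in {x : Fin d → ℝ | x ⬝ᵥ x ≤ 1}, x ⬝ᵥ (M *ᵥ x) =
      M.trace * volume.real {x : Fin d → ℝ | x ⬝ᵥ x ≤ 1} := by
  have h : ∀ x : Fin d → ℝ, x ⬝ᵥ (M *ᵥ x) = ∑ i, (Pi.single i 1 ⬝ᵥ x) * (M i ⬝ᵥ x) := fun x => by
    simp only [single_one_dotProduct]; rfl
  simp only [h]
  rw [integral_finsetSum _ fun i _ => integrableOn_dotProduct_self_le_one (by fun_prop),
    Finset.mul_sum]
  simp only [setIntegral_ball_dotProduct_mul_dotProduct]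
  simp only [single_one_dotProduct, trace, diag, Finset.sum_mul]

theorem setIntegral_ball_mulVec_dotProduct_self {d : ℕ} {M : Matrix (Fin d) (Fin d) ℝ}
    (hM : M.IsSymm) :
    ((d : ℝ) + 2) * ∫ x in {x : Fin d → ℝ | x ⬝ᵥ x ≤ 1}, (M *ᵥ x) ⬝ᵥ (M *ᵥ x) =
      (M * M).trace * volume.real {x : Fin d → ℝ | x ⬝ᵥ x ≤ 1} := by
  rw [← setIntegral_ball_quadratic]
  congr 2 with x
  rw [← mulVec_mulVec, dotProduct_mulVec x, ← mulVec_transpose, hM.eq]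

theorem setIntegral_ball_quadratic_sq {d : ℕ} {M : Matrix (Fin d) (Fin d) ℝ} (hM : M.IsSymm) :
    ((d : ℝ) + 4) * ((d : ℝ) + 2) * ∫ x in {x : Fin d → ℝ | x ⬝ᵥ x ≤ 1}, (x ⬝ᵥ (M *ᵥ x)) ^ 2 =
      (M.trace ^ 2 + 2 * (M * M).trace) * volume.real {x : Fin d → ℝ | x ⬝ᵥ x ≤ 1} := by
  have hcoord : ∀ i, ((d : ℝ) + 4) * ∫ x in {x : Fin d → ℝ | x ⬝ᵥ x ≤ 1},
      (Pi.single i 1 ⬝ᵥ x) * ((x ⬝ᵥ (M *ᵥ x)) * (M i ⬝ᵥ x)) =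
      ∫ x in {x : Fin d → ℝ | x ⬝ᵥ x ≤ 1},
        (2 * ((M i ⬝ᵥ x) * (M i ⬝ᵥ x)) + (x ⬝ᵥ (M *ᵥ x)) * M i i) := by
    intro i
    have h := setIntegral_ball_dotProduct_mul (k := 2) (Pi.single i 1)
      (p := fun x => (x ⬝ᵥ (M *ᵥ x)) * (M i ⬝ᵥ x))
      (p' := fun x => 2 * ((M i ⬝ᵥ x) * (M i ⬝ᵥ x)) + (x ⬝ᵥ (M *ᵥ x)) * M i i)
      (by fun_prop) (by fun_prop)
      (fun x => by
        have := (hasDerivAt_quadratic_add_smul hM x (Pi.single i 1)).fun_mul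
          (hasDerivAt_dotProduct_add_smul (M i) x (Pi.single i 1) 0)
        refine this.congr_deriv ?_
        simp only [single_one_dotProduct, dotProduct_single_one, zero_smul, add_zero, mulVec]
        ring)
      (fun c _ x => by
        simp only [mulVec_smul, smul_dotProduct, dotProduct_smul, smul_eq_mul]; ring)
      (fun c _ x => by
        simp only [mulVec_smul, smul_dotProduct, dotProduct_smul, smul_eq_mul]; ring)
    rw [← h]
    push_cast
    ring
  have hsum : ((d : ℝ) + 4) * ∫ x in {x : Fin d → ℝ | x ⬝ᵥ x ≤ 1}, (x ⬝ᵥ (M *ᵥ x)) ^ 2 =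
      ∫ x in {x : Fin d → ℝ | x ⬝ᵥ x ≤ 1},
        (2 * ((M *ᵥ x) ⬝ᵥ (M *ᵥ x)) + (x ⬝ᵥ (M *ᵥ x)) * M.trace) := by
    have h1 : ∀ x : Fin d → ℝ, (x ⬝ᵥ (M *ᵥ x)) ^ 2 =
        ∑ i, (Pi.single i 1 ⬝ᵥ x) * ((x ⬝ᵥ (M *ᵥ x)) * (M i ⬝ᵥ x)) := fun x => by
      simp only [single_one_dotProduct, mul_left_comm _ (x ⬝ᵥ (M *ᵥ x)), ← Finset.mul_sum, sq]
      rfl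
    have h2 : ∀ x : Fin d → ℝ, 2 * ((M *ᵥ x) ⬝ᵥ (M *ᵥ x)) + (x ⬝ᵥ (M *ᵥ x)) * M.trace =
        ∑ i, (2 * ((M i ⬝ᵥ x) * (M i ⬝ᵥ x)) + (x ⬝ᵥ (M *ᵥ x)) * M i i) := fun x => by
      rw [Finset.sum_add_distrib, ← Finset.mul_sum, ← Finset.mul_sum]
      rfl
    simp only [h1, h2]
    rw [integral_finsetSum _ fun i _ => integrableOn_dotProduct_self_le_one (by fun_prop),
      integral_finsetSum _ fun i _ => integrableOn_dotProduct_self_le_one (by fun_prop),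
      Finset.mul_sum]
    simp only [hcoord]
  rw [integral_add (integrableOn_dotProduct_self_le_one (by fun_prop))
    (integrableOn_dotProduct_self_le_one (by fun_prop)), integral_const_mul,
    integral_mul_const] at hsum
  linear_combination ((d : ℝ) + 2) * hsum + 2 * setIntegral_ball_mulVec_dotProduct_self hM +
    M.trace * setIntegral_ball_quadratic M

theorem setIntegral_ball_sq_mul_quadratic_sq_le {d : ℕ} {M : Matrix (Fin d) (Fin d) ℝ}
    (hM : M.IsSymm) {θ : Fin d → ℝ} (hθ : θ ⬝ᵥ θ = 1) :
    ((d : ℝ) + 6) / 2 * ∫ x in {x : Fin d → ℝ | x ⬝ᵥ x ≤ 1},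
        (x ⬝ᵥ θ) ^ 2 * (x ⬝ᵥ (M *ᵥ x)) ^ 2 ≤
      (M.trace ^ 2 + 10 * (M * M).trace) / (((d : ℝ) + 2) * (d + 4)) *
        volume.real {x : Fin d → ℝ | x ⬝ᵥ x ≤ 1} := by
  have hstein := setIntegral_ball_dotProduct_mul (k := 4) θ
    (p := fun x => (θ ⬝ᵥ x) * (x ⬝ᵥ (M *ᵥ x)) ^ 2)
    (p' := fun x => (x ⬝ᵥ (M *ᵥ x)) ^ 2 + 4 * ((θ ⬝ᵥ x) * (x ⬝ᵥ (M *ᵥ x)) * (θ ⬝ᵥ (M *ᵥ x))))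
    (by fun_prop) (by fun_prop)
    (fun x => by
      have := (hasDerivAt_dotProduct_add_smul θ x θ 0).fun_mul
        ((hasDerivAt_quadratic_add_smul hM x θ).fun_pow 2)
      refine this.congr_deriv ?_
      simp only [zero_smul, add_zero, hθ]
      push_cast
      ring)
    (fun c _ x => by
      simp only [mulVec_smul, smul_dotProduct, dotProduct_smul, smul_eq_mul]; ring)
    (fun c _ x => by
      simp only [mulVec_smul, smul_dotProduct, dotProduct_smul, smul_eq_mul]; ring)
  have hpoint : ∀ x : Fin d → ℝ,
      (x ⬝ᵥ (M *ᵥ x)) ^ 2 + 4 * ((θ ⬝ᵥ x) * (x ⬝ᵥ (M *ᵥ x)) * (θ ⬝ᵥ (M *ᵥ x))) ≤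
      (x ⬝ᵥ (M *ᵥ x)) ^ 2 + ((d : ℝ) + 6) / 2 * ((x ⬝ᵥ θ) ^ 2 * (x ⬝ᵥ (M *ᵥ x)) ^ 2) +
        8 / ((d : ℝ) + 6) * ((M *ᵥ x) ⬝ᵥ (M *ᵥ x)) := by
    intro x
    have hcs : (θ ⬝ᵥ (M *ᵥ x)) ^ 2 ≤ (M *ᵥ x) ⬝ᵥ (M *ᵥ x) := by
      have := Finset.sum_mul_sq_le_sq_mul_sq Finset.univ θ (M *ᵥ x)
      simp only [sq (θ _), sq ((M *ᵥ x) _)] at this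
      change (θ ⬝ᵥ (M *ᵥ x)) ^ 2 ≤ (θ ⬝ᵥ θ) * ((M *ᵥ x) ⬝ᵥ (M *ᵥ x)) at this
      rwa [hθ, one_mul] at this
    have hcs' := mul_le_mul_of_nonneg_left hcs (by positivity : (0 : ℝ) ≤ 8 / (d + 6))
    rw [dotProduct_comm x θ]
    generalize θ ⬝ᵥ (M *ᵥ x) = w at *
    generalize x ⬝ᵥ (M *ᵥ x) = q at *
    generalize θ ⬝ᵥ x = u at *
    have hsq : ((d : ℝ) + 6) / 2 * (u ^ 2 * q ^ 2) + 8 / (d + 6) * w ^ 2 - 4 * (u * q * w) =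
        ((d + 6) * (u * q) - 4 * w) ^ 2 / (2 * (d + 6)) := by
      field_simp
      ring
    have : 0 ≤ ((d + 6) * (u * q) - 4 * w) ^ 2 / (2 * ((d : ℝ) + 6)) := by positivity
    linarith
  have hmono := setIntegral_mono (s := {x : Fin d → ℝ | x ⬝ᵥ x ≤ 1})
    (integrableOn_dotProduct_self_le_one (by fun_prop))
    (integrableOn_dotProduct_self_le_one (by fun_prop)) hpoint
  rw [← hstein, integral_add (integrableOn_dotProduct_self_le_one (by fun_prop))
    (integrableOn_dotProduct_self_le_one (by fun_prop)),
    integral_add (integrableOn_dotProduct_self_le_one (by fun_prop))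
    (integrableOn_dotProduct_self_le_one (by fun_prop)), integral_const_mul,
    integral_const_mul] at hmono
  have hlhs : ∀ x : Fin d → ℝ, (θ ⬝ᵥ x) * ((θ ⬝ᵥ x) * (x ⬝ᵥ (M *ᵥ x)) ^ 2) =
      (x ⬝ᵥ θ) ^ 2 * (x ⬝ᵥ (M *ᵥ x)) ^ 2 := fun x => by rw [dotProduct_comm x θ]; ring
  simp only [hlhs] at hmono
  have h2 := setIntegral_ball_mulVec_dotProduct_self hM
  have h4 := setIntegral_ball_quadratic_sq hM
  have hnn : 0 ≤ ∫ x in {x : Fin d → ℝ | x ⬝ᵥ x ≤ 1}, (M *ᵥ x) ⬝ᵥ (M *ᵥ x) :=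
    integral_nonneg fun x => Finset.sum_nonneg fun i _ => mul_self_nonneg _
  have hcoef : 8 / ((d : ℝ) + 6) ≤ 8 / (d + 4) := by gcongr; norm_num
  have h8 := mul_le_mul_of_nonneg_right hcoef hnn
  push_cast at hmono
  calc _ ≤ (∫ x in {x : Fin d → ℝ | x ⬝ᵥ x ≤ 1}, (x ⬝ᵥ (M *ᵥ x)) ^ 2) +
        8 / ((d : ℝ) + 4) * ∫ x in {x : Fin d → ℝ | x ⬝ᵥ x ≤ 1}, (M *ᵥ x) ⬝ᵥ (M *ᵥ x) := by
        linarith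
    _ = _ := by
      field_simp
      linear_combination h4 + 8 * h2

theorem one_le_det_and_det_le_exp {d : ℕ} {g : Matrix (Fin d) (Fin d) ℝ} (hg : g.IsHermitian)
    (hone : ∀ y : Fin d → ℝ, y ⬝ᵥ y ≤ y ⬝ᵥ (g *ᵥ y)) :
    1 ≤ g.det ∧ g.det ≤ exp (g.trace - d) := by
  have heig : ∀ i, 1 ≤ hg.eigenvalues i := by
    intro i
    have hunit : (hg.eigenvectorBasis i).ofLp ⬝ᵥ (hg.eigenvectorBasis i).ofLp = 1 := by
      have h := hg.eigenvectorBasis.orthonormal.1 i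
      rw [EuclideanSpace.norm_eq, Real.sqrt_eq_one] at h
      simpa [dotProduct, sq] using h
    have h := hone (hg.eigenvectorBasis i).ofLp
    rw [hunit] at h
    rw [hg.eigenvalues_eq]
    simpa using h
  rw [hg.det_eq_prod_eigenvalues, hg.trace_eq_sum_eigenvalues]
  simp only [RCLike.ofReal_real_eq_id, id]
  refine ⟨Finset.one_le_prod fun i _ => heig i, ?_⟩
  have hsum : (∑ i, hg.eigenvalues i) - d = ∑ i, (hg.eigenvalues i - 1) := by simp
  rw [hsum, exp_sum]
  exact Finset.prod_le_prod (fun i _ => zero_le_one.trans (heig i)) fun i _ => by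
    linarith [add_one_le_exp (hg.eigenvalues i - 1)]

theorem one_le_Sdens_and_Sdens_le_exp {d m : ℕ} (M : Fin m → Matrix (Fin d) (Fin d) ℝ)
    (x : Fin d → ℝ) :
    1 ≤ Sdens M x ∧ Sdens M x ≤ exp (2 * ∑ k, (M k *ᵥ x) ⬝ᵥ (M k *ᵥ x)) := by
  have hherm : (gMat M x).IsHermitian := by
    rw [IsHermitian, conjTranspose_eq_transpose_of_trivial, gMat]
    simp [transpose_sum, transpose_vecMulVec]
  have hone : ∀ y : Fin d → ℝ, y ⬝ᵥ y ≤ y ⬝ᵥ (gMat M x *ᵥ y) := by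
    intro y
    have : y ⬝ᵥ (gMat M x *ᵥ y) = y ⬝ᵥ y + 4 * ∑ k, (y ⬝ᵥ (M k *ᵥ x)) ^ 2 := by
      simp only [gMat, add_mulVec, one_mulVec, smul_mulVec, sum_mulVec, dotProduct_add,
        dotProduct_smul, dotProduct_sum, vecMulVec_mulVec, smul_eq_mul]
      congr 2
      refine Finset.sum_congr rfl fun k _ => ?_
      rw [dotProduct_comm (M k *ᵥ x) y]
      simp [sq]
    rw [this]
    have : 0 ≤ ∑ k, (y ⬝ᵥ (M k *ᵥ x)) ^ 2 := Finset.sum_nonneg fun k _ => sq_nonneg _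
    linarith
  have htr : (gMat M x).trace - d = 2 * (2 * ∑ k, (M k *ᵥ x) ⬝ᵥ (M k *ᵥ x)) := by
    simp only [gMat, trace_add, trace_one, Fintype.card_fin, trace_smul, trace_sum,
      trace_vecMulVec, smul_eq_mul]
    ring
  obtain ⟨h1, h2⟩ := one_le_det_and_det_le_exp hherm hone
  refine ⟨Real.one_le_sqrt.2 h1, ?_⟩
  rw [htr, two_mul, exp_add] at h2
  exact (Real.sqrt_le_sqrt h2).trans_eq (Real.sqrt_mul_self (exp_pos _).le)

theorem mulVec_dotProduct_self_le_Lam {d m : ℕ} (M : Fin m → Matrix (Fin d) (Fin d) ℝ) (k : Fin m)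
    (x : Fin d → ℝ) : (M k *ᵥ x) ⬝ᵥ (M k *ᵥ x) ≤ Lam M ^ 2 * (x ⬝ᵥ x) := by
  have hnorm : ∀ y : Fin d → ℝ, ‖WithLp.toLp 2 y‖ ^ 2 = y ⬝ᵥ y := fun y => by
    simp [EuclideanSpace.real_norm_sq_eq, dotProduct, ← sq]
  have hle : ‖toEuclideanCLM (𝕜 := ℝ) (M k)‖ ≤ Lam M :=
    le_ciSup (f := fun j => ‖toEuclideanCLM (𝕜 := ℝ) (M j)‖) (Set.finite_range _).bddAbove k
  have h := (toEuclideanCLM (𝕜 := ℝ) (M k)).le_of_opNorm_le hle (WithLp.toLp 2 x)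
  rw [toEuclideanCLM_toLp] at h
  rw [← hnorm, ← hnorm, ← mul_pow]
  gcongr

theorem exp_le_one_add_add_sq_mul_exp {s : ℝ} (hs : 0 ≤ s) : exp s ≤ 1 + s + s ^ 2 * exp s := by
  have h : exp s ≤ 1 + s * exp s := by
    have := mul_le_mul_of_nonneg_right (add_one_le_exp (-s)) (exp_pos s).le
    rw [← exp_add, neg_add_cancel, exp_zero] at this
    linarith
  nlinarith [mul_le_mul_of_nonneg_left h hs]

theorem continuous_Sdens {d m : ℕ} (M : Fin m → Matrix (Fin d) (Fin d) ℝ) :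
    Continuous (Sdens M) := by
  unfold Sdens gMat
  exact (Continuous.matrix_det (by fun_prop)).sqrt

theorem dotProduct_self_eq_sum_sq {d : ℕ} (x : Fin d → ℝ) : ∑ i, x i ^ 2 = x ⬝ᵥ x := by
  simp [dotProduct, sq]

theorem regionR_subset_ball {d m : ℕ} (M : Fin m → Matrix (Fin d) (Fin d) ℝ) :
    regionR M ⊆ {x | x ⬝ᵥ x ≤ 1} := by
  intro x hx
  have h : ∑ i, x i ^ 2 + ∑ j, (x ⬝ᵥ (M j *ᵥ x)) ^ 2 ≤ 1 := hx
  rw [dotProduct_self_eq_sum_sq x] at h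
  rw [Set.mem_ofPred_eq]
  linarith [Finset.sum_nonneg fun j (_ : j ∈ Finset.univ) => sq_nonneg (x ⬝ᵥ (M j *ᵥ x))]

theorem setIntegral_regionR_Sdens_pos {d m : ℕ} (M : Fin m → Matrix (Fin d) (Fin d) ℝ) :
    0 < ∫ x in regionR M, Sdens M x := by
  have hint : IntegrableOn (Sdens M) (regionR M) :=
    (integrableOn_dotProduct_self_le_one (continuous_Sdens M)).mono_set (regionR_subset_ball M)
  have hnn : 0 ≤ᵐ[volume.restrict (regionR M)] Sdens M :=
    Filter.Eventually.of_forall fun x => Real.sqrt_nonneg _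
  rw [setIntegral_pos_iff_support_of_nonneg_ae hnn hint]
  have hU : IsOpen {x : Fin d → ℝ | ∑ i, x i ^ 2 + ∑ j, (x ⬝ᵥ (M j *ᵥ x)) ^ 2 < 1} :=
    isOpen_lt (by fun_prop) continuous_const
  refine (hU.measure_pos volume ⟨0, by simp⟩).trans_le (measure_mono fun x hx => ⟨?_, ?_⟩)
  · exact (zero_lt_one.trans_le (one_le_Sdens_and_Sdens_le_exp M x).1).ne'
  · exact le_of_lt (show ∑ i, x i ^ 2 + ∑ j, (x ⬝ᵥ (M j *ᵥ x)) ^ 2 < 1 from hx)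

theorem trace_mul_self_nonneg_of_isSymm {d : ℕ} {M : Matrix (Fin d) (Fin d) ℝ} (hM : M.IsSymm) :
    0 ≤ (M * M).trace := by
  have h : (M * M).trace = ∑ i, ∑ j, M i j ^ 2 := by
    simp only [trace, diag, mul_apply]
    exact Finset.sum_congr rfl fun i _ => Finset.sum_congr rfl fun j _ => by
      rw [hM.apply i j, sq]
  rw [h]
  positivity

theorem le_setIntegral_regionR_sq {d m : ℕ} {M : Fin m → Matrix (Fin d) (Fin d) ℝ}
    (hM : ∀ j, (M j).IsSymm) {θ : Fin d → ℝ} (hθ : θ ⬝ᵥ θ = 1) :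
    (1 / ((d : ℝ) + 2) - (Bconst M + 10 * Aconst M) / (((d : ℝ) + 2) * (d + 4))) *
      volume.real {x : Fin d → ℝ | x ⬝ᵥ x ≤ 1} ≤ ∫ x in regionR M, (x ⬝ᵥ θ) ^ 2 := by
  set q : (Fin d → ℝ) → ℝ := fun x => ∑ j, (x ⬝ᵥ (M j *ᵥ x)) ^ 2 with hqdef
  have hqc : Continuous q := by fun_prop
  have hq0 : ∀ x, 0 ≤ q x := fun x => Finset.sum_nonneg fun j _ => sq_nonneg _
  have hqh : ∀ c > (0 : ℝ), ∀ x, q (c • x) = c ^ 4 * q x := fun c _ x => by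
    simp only [hqdef, Finset.mul_sum, mulVec_smul, smul_dotProduct, dotProduct_smul, smul_eq_mul]
    exact Finset.sum_congr rfl fun j _ => by ring
  have hfc : Continuous fun x : Fin d → ℝ => (x ⬝ᵥ θ) ^ 2 := by fun_prop
  have hfh : ∀ c > (0 : ℝ), ∀ x : Fin d → ℝ, ((c • x) ⬝ᵥ θ) ^ 2 = c ^ 2 * (x ⬝ᵥ θ) ^ 2 :=
    fun c _ x => by rw [smul_dotProduct, smul_eq_mul, mul_pow]
  have hr0 : ∀ x : Fin d → ℝ, 0 ≤ x ⬝ᵥ x := fun x => Finset.sum_nonneg fun i _ => mul_self_nonneg _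
  have hrh : ∀ c > (0 : ℝ), ∀ x : Fin d → ℝ, ((c • x) ⬝ᵥ (c • x)) ^ 2 = c ^ 4 * (x ⬝ᵥ x) ^ 2 :=
    fun c _ x => by simp only [smul_dotProduct, dotProduct_smul, smul_eq_mul]; ring
  have hball : {x : Fin d → ℝ | (x ⬝ᵥ x) ^ 2 ≤ 1} = {x | x ⬝ᵥ x ≤ 1} := by
    ext x
    exact sq_le_one_iff₀ (hr0 x)
  set G : (Fin d → ℝ) → ℝ := fun x => (x ⬝ᵥ x) ^ 2 + 2 * q x with hG
  have hGc : Continuous G := by fun_prop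
  have hKB : {x | G x ≤ 1} ⊆ {x : Fin d → ℝ | x ⬝ᵥ x ≤ 1} := by
    intro x (hx : G x ≤ 1)
    rw [← hball, Set.mem_ofPred_eq]
    linarith [hq0 x]
  have hK : IsCompact {x | G x ≤ 1} :=
    (isCompact_dotProduct_self_le_one d).of_isClosed_subset
      (isClosed_le hGc continuous_const) hKB
  have hKR : {x | G x ≤ 1} ⊆ regionR M := by
    intro x (hx : (x ⬝ᵥ x) ^ 2 + 2 * q x ≤ 1)
    rw [regionR, Set.mem_ofPred_eq, dotProduct_self_eq_sum_sq x]
    change x ⬝ᵥ x + q x ≤ 1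
    have := abs_le_of_sq_le_sq (a := x ⬝ᵥ x) (b := 1 - q x) (by nlinarith [sq_nonneg (q x)])
      (by nlinarith [sq_nonneg (x ⬝ᵥ x)])
    linarith [(le_abs_self _).trans this]
  have h1 := setIntegral_sublevel_mul_one_sub (k := 2) (p := 4) (by norm_num) hfc hGc hfh
    (fun c hc x => by simp only [hG, hrh c hc, hqh c hc]; ring)
    (fun x => by have := hq0 x; positivity) hK
  have h2 := setIntegral_sublevel_mul_one_sub (k := 2) (p := 4)
    (G := fun x : Fin d → ℝ => (x ⬝ᵥ x) ^ 2) (by norm_num) hfc (by fun_prop) hfh hrh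
    (fun x => by positivity) (by rw [hball]; exact isCompact_dotProduct_self_le_one d)
  rw [hball] at h2
  have h3 : ∫ x in {x : Fin d → ℝ | x ⬝ᵥ x ≤ 1}, (x ⬝ᵥ θ) ^ 2 * (1 - G x) ≤
      ∫ x in {x | G x ≤ 1}, (x ⬝ᵥ θ) ^ 2 * (1 - G x) := by
    have hi : IntegrableOn (fun x : Fin d → ℝ => (x ⬝ᵥ θ) ^ 2 * (1 - G x)) {x | x ⬝ᵥ x ≤ 1} :=
      integrableOn_dotProduct_self_le_one (by fun_prop)
    have h := setIntegral_mono hi (hi.indicator hK.measurableSet) fun x => by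
      by_cases hx : x ∈ {x | G x ≤ 1}
      · rw [Set.indicator_of_mem hx]
      · rw [Set.indicator_of_notMem hx]
        exact mul_nonpos_of_nonneg_of_nonpos (sq_nonneg _) (by
          linarith [not_le.1 fun h : G x ≤ 1 => hx h])
    rwa [setIntegral_indicator hK.measurableSet, Set.inter_eq_right.2 hKB] at h
  have h4 : ∫ x in {x : Fin d → ℝ | x ⬝ᵥ x ≤ 1}, (x ⬝ᵥ θ) ^ 2 * (1 - G x) =
      (∫ x in {x : Fin d → ℝ | x ⬝ᵥ x ≤ 1}, (x ⬝ᵥ θ) ^ 2 * (1 - (x ⬝ᵥ x) ^ 2)) -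
        2 * ∑ j, ∫ x in {x : Fin d → ℝ | x ⬝ᵥ x ≤ 1},
          (x ⬝ᵥ θ) ^ 2 * (x ⬝ᵥ (M j *ᵥ x)) ^ 2 := by
    rw [← integral_finsetSum _ fun j _ => integrableOn_dotProduct_self_le_one (by fun_prop),
      ← integral_const_mul, ← integral_sub (integrableOn_dotProduct_self_le_one (by fun_prop))
      (integrableOn_dotProduct_self_le_one (by fun_prop))]
    congr 1 with x
    rw [← Finset.mul_sum]
    simp only [hG, hqdef]
    ring
  have h5 : ((d : ℝ) + 2) * ∫ x in {x : Fin d → ℝ | x ⬝ᵥ x ≤ 1}, (x ⬝ᵥ θ) ^ 2 =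
      volume.real {x : Fin d → ℝ | x ⬝ᵥ x ≤ 1} := by
    have h := setIntegral_ball_dotProduct_mul_dotProduct θ θ
    rw [hθ, one_mul] at h
    rw [← h]
    congr 2 with x
    rw [dotProduct_comm x θ, sq]
  have h6 : ((d : ℝ) + 6) / 2 * ∑ j, ∫ x in {x : Fin d → ℝ | x ⬝ᵥ x ≤ 1},
        (x ⬝ᵥ θ) ^ 2 * (x ⬝ᵥ (M j *ᵥ x)) ^ 2 ≤
      (Bconst M + 10 * Aconst M) / (((d : ℝ) + 2) * (d + 4)) *
        volume.real {x : Fin d → ℝ | x ⬝ᵥ x ≤ 1} := by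
    rw [Aconst, Bconst, Finset.mul_sum, Finset.mul_sum, ← Finset.sum_add_distrib,
      Finset.sum_div, Finset.sum_mul]
    exact Finset.sum_le_sum fun j _ => setIntegral_ball_sq_mul_quadratic_sq_le (hM j) hθ
  have h7 : ∫ x in {x | G x ≤ 1}, (x ⬝ᵥ θ) ^ 2 ≤ ∫ x in regionR M, (x ⬝ᵥ θ) ^ 2 :=
    setIntegral_mono_set
      ((integrableOn_dotProduct_self_le_one hfc).mono_set (regionR_subset_ball M))
      (Filter.Eventually.of_forall fun x => sq_nonneg _) hKR.eventuallyLE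
  rw [h4] at h3
  have h8 := mul_le_mul_of_nonneg_left h3 (by positivity : (0 : ℝ) ≤ d + 2 + 4)
  push_cast at h1 h2
  have h9 : 1 / ((d : ℝ) + 2) * volume.real {x : Fin d → ℝ | x ⬝ᵥ x ≤ 1} =
      ∫ x in {x : Fin d → ℝ | x ⬝ᵥ x ≤ 1}, (x ⬝ᵥ θ) ^ 2 := by
    rw [← h5]
    field_simp
  rw [sub_mul, h9]
  linarith

theorem setIntegral_regionR_Sdens_le {d m : ℕ} {M : Fin m → Matrix (Fin d) (Fin d) ℝ}
    (hM : ∀ j, (M j).IsSymm) (hLam0 : 0 ≤ Lam M) (hLam : Lam M ≤ 1) :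
    ∫ x in regionR M, Sdens M x ≤
      (1 + (2 * Aconst M / ((d : ℝ) + 2) + 4 * (m : ℝ) ^ 2 * exp (2 * m) * Lam M ^ 4)) *
        volume.real {x : Fin d → ℝ | x ⬝ᵥ x ≤ 1} := by
  set c := 4 * (m : ℝ) ^ 2 * exp (2 * m) * Lam M ^ 4 with hc
  have hSB : IntegrableOn (Sdens M) {x | x ⬝ᵥ x ≤ 1} :=
    integrableOn_dotProduct_self_le_one (continuous_Sdens M)
  have h1 : ∫ x in regionR M, Sdens M x ≤ ∫ x in {x : Fin d → ℝ | x ⬝ᵥ x ≤ 1}, Sdens M x :=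
    setIntegral_mono_set hSB (Filter.Eventually.of_forall fun x => Real.sqrt_nonneg _)
      (regionR_subset_ball M).eventuallyLE
  have hpoint : ∀ x ∈ {x : Fin d → ℝ | x ⬝ᵥ x ≤ 1},
      Sdens M x ≤ (1 + c) + 2 * ∑ k, (M k *ᵥ x) ⬝ᵥ (M k *ᵥ x) := by
    intro x (hx : x ⬝ᵥ x ≤ 1)
    refine (one_le_Sdens_and_Sdens_le_exp M x).2.trans ?_
    have ht0 : 0 ≤ ∑ k, (M k *ᵥ x) ⬝ᵥ (M k *ᵥ x) :=
      Finset.sum_nonneg fun k _ => Finset.sum_nonneg fun i _ => mul_self_nonneg _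
    have ht : ∑ k, (M k *ᵥ x) ⬝ᵥ (M k *ᵥ x) ≤ m * Lam M ^ 2 := by
      have := Finset.sum_le_sum fun k (_ : k ∈ Finset.univ) =>
        (mulVec_dotProduct_self_le_Lam M k x).trans (mul_le_of_le_one_right (sq_nonneg _) hx)
      simpa using this
    generalize ∑ k, (M k *ᵥ x) ⬝ᵥ (M k *ᵥ x) = t at *
    have htm : t ≤ m := ht.trans (mul_le_of_le_one_right (by positivity) (pow_le_one₀ hLam0 hLam))
    have hrem : (2 * t) ^ 2 * exp (2 * t) ≤ (2 * (m * Lam M ^ 2)) ^ 2 * exp (2 * m) := by gcongr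
    have := exp_le_one_add_add_sq_mul_exp (by positivity : 0 ≤ 2 * t)
    have hceq : (2 * (m * Lam M ^ 2)) ^ 2 * exp (2 * m) = c := by rw [hc]; ring
    linarith
  have h2 := setIntegral_mono_on hSB (integrableOn_dotProduct_self_le_one (by fun_prop))
    (isCompact_dotProduct_self_le_one d).measurableSet hpoint
  rw [integral_add (integrableOn_dotProduct_self_le_one (by fun_prop))
    (integrableOn_dotProduct_self_le_one (by fun_prop)), integral_const_mul, setIntegral_const,
    integral_finsetSum _ fun k _ => integrableOn_dotProduct_self_le_one (by fun_prop)] at h2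
  have h3 : ((d : ℝ) + 2) * ∑ k, ∫ x in {x : Fin d → ℝ | x ⬝ᵥ x ≤ 1},
      (M k *ᵥ x) ⬝ᵥ (M k *ᵥ x) = Aconst M * volume.real {x : Fin d → ℝ | x ⬝ᵥ x ≤ 1} := by
    rw [Finset.mul_sum, Aconst, Finset.sum_mul]
    exact Finset.sum_congr rfl fun k _ => setIntegral_ball_mulVec_dotProduct_self (hM k)
  refine (h1.trans h2).trans_eq ?_
  rw [smul_eq_mul]
  field_simp
  linear_combination 2 * h3

theorem sub_sub_mul_le_div {a X Y V N D : ℝ} (ha : 0 ≤ a) (hX : 0 ≤ X) (hY : 0 ≤ Y) (hV : 0 ≤ V)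
    (hN0 : 0 ≤ N) (hN : (a - X) * V ≤ N) (hD0 : 0 < D) (hD : D ≤ (1 + Y) * V) :
    a - X - a * Y ≤ N / D := by
  rcases le_total (a - X - a * Y) 0 with hz | hz
  · exact hz.trans (div_nonneg hN0 hD0.le)
  · rw [le_div_iff₀ hD0]
    refine (mul_le_mul_of_nonneg_left hD hz).trans (le_trans ?_ hN)
    rw [← mul_assoc]
    refine mul_le_mul_of_nonneg_right ?_ hV
    nlinarith [mul_nonneg hX hY, mul_nonneg ha (sq_nonneg Y)]

theorem stmt15 (d D : ℕ) (hd : 1 ≤ d) (hD : d < D) :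
    ∃ C > 0, ∀ M : Fin (D - d) → Matrix (Fin d) (Fin d) ℝ,
      (∀ j, (M j).IsSymm) → Lam M ≤ 1 →
      ∀ θstar : Fin d → ℝ, ∑ i, θstar i ^ 2 = 1 →
        (∫ x in regionR M, (x ⬝ᵥ θstar) ^ 2 * Sdens M x) / (∫ x in regionR M, Sdens M x)
          ≥ 1 / ((d : ℝ) + 2) -
              (20 * (d : ℝ) ^ 2 + 82 * (d : ℝ) + 76) * Aconst M /
                (((d : ℝ) + 2) ^ 3 * ((d : ℝ) + 4)) -
              (11 * (d : ℝ) + 24) * Bconst M / (2 * ((d : ℝ) + 2) ^ 2 * ((d : ℝ) + 4)) -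
              C * Lam M ^ 4 := by
  generalize D - d = m
  refine ⟨4 * (m : ℝ) ^ 2 * exp (2 * m) + 1, by positivity, fun M hM hLam θ hθ => ?_⟩
  rw [dotProduct_self_eq_sum_sq] at hθ
  have hLam0 : 0 ≤ Lam M := Real.iSup_nonneg fun j => norm_nonneg _
  have hA : 0 ≤ Aconst M := Finset.sum_nonneg fun j _ => trace_mul_self_nonneg_of_isSymm (hM j)
  have hB : 0 ≤ Bconst M := Finset.sum_nonneg fun j _ => sq_nonneg _
  have hnum : ∫ x in regionR M, (x ⬝ᵥ θ) ^ 2 ≤ ∫ x in regionR M, (x ⬝ᵥ θ) ^ 2 * Sdens M x := by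
    have hS := continuous_Sdens M
    exact setIntegral_mono
      ((integrableOn_dotProduct_self_le_one (by fun_prop)).mono_set (regionR_subset_ball M))
      ((integrableOn_dotProduct_self_le_one (by fun_prop)).mono_set (regionR_subset_ball M))
      fun x => le_mul_of_one_le_right (sq_nonneg _) (one_le_Sdens_and_Sdens_le_exp M x).1
  refine le_trans ?_ (sub_sub_mul_le_div (by positivity) (by positivity) (by positivity)
    measureReal_nonneg
    (integral_nonneg fun x => mul_nonneg (sq_nonneg _) (Real.sqrt_nonneg _))
    ((le_setIntegral_regionR_sq hM hθ).trans hnum) (setIntegral_regionR_Sdens_pos M)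
    (setIntegral_regionR_Sdens_le hM hLam0 hLam))
  have hL : 0 ≤ Lam M ^ 4 := by positivity
  have hE : 0 ≤ 4 * (m : ℝ) ^ 2 * exp (2 * m) * Lam M ^ 4 := by positivity
  rw [add_mul _ (1 : ℝ), one_mul]
  generalize 4 * (m : ℝ) ^ 2 * exp (2 * m) * Lam M ^ 4 = E at *
  have hd0 : (0 : ℝ) ≤ d := d.cast_nonneg
  have hAcoef : (20 * (d : ℝ) ^ 2 + 82 * d + 76) * Aconst M / (((d : ℝ) + 2) ^ 3 * (d + 4)) =
      10 * Aconst M / (((d : ℝ) + 2) * (d + 4)) + 1 / ((d : ℝ) + 2) * (2 * Aconst M / (d + 2)) +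
        (8 * (d : ℝ) ^ 2 + 30 * d + 20) * Aconst M / (((d : ℝ) + 2) ^ 3 * (d + 4)) := by
    field_simp
    ring
  have hBcoef : (11 * (d : ℝ) + 24) * Bconst M / (2 * ((d : ℝ) + 2) ^ 2 * (d + 4)) =
      Bconst M / (((d : ℝ) + 2) * (d + 4)) +
        (9 * (d : ℝ) + 20) * Bconst M / (2 * ((d : ℝ) + 2) ^ 2 * (d + 4)) := by
    field_simp
    ring
  have hArest : 0 ≤ (8 * (d : ℝ) ^ 2 + 30 * d + 20) * Aconst M / (((d : ℝ) + 2) ^ 3 * (d + 4)) := by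
    positivity
  have hBrest : 0 ≤ (9 * (d : ℝ) + 20) * Bconst M / (2 * ((d : ℝ) + 2) ^ 2 * (d + 4)) := by
    positivity
  have hErest : 1 / ((d : ℝ) + 2) * E ≤ E :=
    mul_le_of_le_one_left hE ((div_le_one (by positivity)).2 (by linarith))
  rw [hAcoef, hBcoef, mul_add, add_div]
  linarith
end

section
/- Let d ≥ 1, let M be a symmetric d×d real matrix, and let y ∈ ℝ^d be a unit vector. Then ∫_{S^{d−1}} (θ·y)² · (θᵀ M θ)² dσ(θ) ≤ (π^{d/2}/Γ(d/2+3)) · ( (21/4)·tr(M²) + (3/2)·(tr M)² ). -/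
open MeasureTheory Matrix Real Metric

section GaussianMoments

open Set Module

open scoped RealInnerProductSpace

section LineDeriv

variable {E : Type*} [NormedAddCommGroup E] [InnerProductSpace ℝ E]

theorem HasLineDerivAt.mul_real {f g : E → ℝ} {f' g' : ℝ} {x v : E}
    (hf : HasLineDerivAt ℝ f f' x v) (hg : HasLineDerivAt ℝ g g' x v) :
    HasLineDerivAt ℝ (fun x ↦ f x * g x) (f' * g x + f x * g') x v := by
  simpa [HasLineDerivAt] using! HasDerivAt.fun_mul hf hg

theorem hasLineDerivAt_exp_neg_norm_sq (x v : E) :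
    HasLineDerivAt ℝ (fun x : E ↦ exp (-‖x‖ ^ 2)) (-2 * ⟪x, v⟫ * exp (-‖x‖ ^ 2)) x v := by
  have h : HasLineDerivAt ℝ (fun x : E ↦ exp (-‖x‖ ^ 2)) _ x v :=
    ((hasStrictFDerivAt_norm_sq x).hasFDerivAt.fun_neg.exp).hasLineDerivAt v
  convert h using 1
  simp [-neg_mul]
  ring

theorem hasLineDerivAt_inner_apply (A : E →L[ℝ] E) (u v x : E) :
    HasLineDerivAt ℝ (fun x ↦ ⟪A x, u⟫) ⟪A v, u⟫ x v := by
  simp only [real_inner_comm u]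
  exact (((innerSL ℝ u).comp A).hasFDerivAt (x := x)).hasLineDerivAt v

theorem hasLineDerivAt_quadratic {A : E →L[ℝ] E} (hA : (A : E →ₗ[ℝ] E).IsSymmetric) (v x : E) :
    HasLineDerivAt ℝ (fun x ↦ ⟪x, A x⟫) (2 * ⟪A x, v⟫) x v := by
  have h : HasLineDerivAt ℝ (fun x ↦ ⟪x, A x⟫) (⟪x, A v⟫ + ⟪v, A x⟫) x v :=
    ((hasFDerivAt_id x).inner ℝ (A.hasFDerivAt (x := x))).hasLineDerivAt v
  have h1 : ⟪A x, v⟫ = ⟪x, A v⟫ := hA x v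
  rwa [real_inner_comm (A x) v, ← h1, ← two_mul] at h

theorem hasTemperateGrowth_inner_apply (A : E →L[ℝ] E) (u : E) :
    Function.HasTemperateGrowth (fun x ↦ ⟪A x, u⟫) := by
  have h := ((innerSL ℝ u).comp A).hasTemperateGrowth
  convert h using 2 with x
  simp [real_inner_comm]

theorem quadratic_eq_sum {ι : Type*} [Fintype ι] (b : OrthonormalBasis ι ℝ E) (A : E →L[ℝ] E)
    (x : E) : ⟪x, A x⟫ = ∑ i, ⟪x, b i⟫ * ⟪A x, b i⟫ := by
  rw [← b.sum_inner_mul_inner x (A x)]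
  simp [real_inner_comm]

theorem norm_apply_sq_le_sum_norm_apply_sq {A : E →L[ℝ] E} (hA : (A : E →ₗ[ℝ] E).IsSymmetric)
    {ι : Type*} [Fintype ι] (b : OrthonormalBasis ι ℝ E) {v : E} (hv : ‖v‖ = 1) :
    ‖A v‖ ^ 2 ≤ ∑ i, ‖A (b i)‖ ^ 2 := by
  rw [← b.sum_sq_norm_inner_left]
  refine Finset.sum_le_sum fun i _ ↦ ?_
  have h1 : ⟪A v, b i⟫ = ⟪v, A (b i)⟫ := hA v (b i)
  have h2 := norm_inner_le_norm (𝕜 := ℝ) v (A (b i))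
  rw [h1]
  gcongr
  simpa [hv] using h2

end LineDeriv

variable {E : Type*} [NormedAddCommGroup E] [InnerProductSpace ℝ E] [FiniteDimensional ℝ E]

theorem hasTemperateGrowth_quadratic (A : E →L[ℝ] E) :
    Function.HasTemperateGrowth (fun x ↦ ⟪x, A x⟫) := by
  have h := hasTemperateGrowth_inner_apply A
  simp only [quadratic_eq_sum (stdOrthonormalBasis ℝ E)]
  fun_prop

variable [MeasurableSpace E] [BorelSpace E]

/-- The integral of `f` against the unnormalized Gaussian weight `exp (-‖x‖ ^ 2)`. -/
noncomputable def gaussianMoment (f : E → ℝ) : ℝ := ∫ x, f x * exp (-‖x‖ ^ 2)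

theorem integrable_norm_pow_mul_exp_neg_norm_sq [Nontrivial E] (k : ℕ) :
    Integrable (fun x : E ↦ ‖x‖ ^ k * exp (-‖x‖ ^ 2)) := by
  rw [integrable_fun_norm_addHaar (volume : Measure E) (f := fun r ↦ r ^ k * exp (-r ^ 2))]
  have h := integrableOn_rpow_mul_exp_neg_mul_sq one_pos
    (s := ((finrank ℝ E - 1 + k : ℕ) : ℝ))
    (by linarith [Nat.cast_nonneg (α := ℝ) (finrank ℝ E - 1 + k)])
  refine h.congr_fun (fun r _ ↦ ?_) measurableSet_Ioi
  simp only [rpow_natCast, smul_eq_mul, pow_add, neg_mul, one_mul]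
  ring

theorem Function.HasTemperateGrowth.integrable_mul_exp_neg_norm_sq [Nontrivial E] {f : E → ℝ}
    (hf : f.HasTemperateGrowth) : Integrable (fun x ↦ f x * exp (-‖x‖ ^ 2)) := by
  obtain ⟨k, C, hC⟩ := hf.2 0
  have hcont : Continuous f := hf.1.continuous
  have hdom : Integrable (fun x : E ↦
      C * 2 ^ (k - 1) * (‖x‖ ^ 0 * exp (-‖x‖ ^ 2) + ‖x‖ ^ k * exp (-‖x‖ ^ 2))) :=
    ((integrable_norm_pow_mul_exp_neg_norm_sq 0).add
      (integrable_norm_pow_mul_exp_neg_norm_sq k)).const_mul _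
  refine hdom.mono' (by fun_prop) (.of_forall fun x ↦ ?_)
  have h1 : ‖f x‖ ≤ C * (1 + ‖x‖) ^ k := by simpa using hC x
  have hC0 : 0 ≤ C := by
    have h0 := (norm_nonneg _).trans (hC 0)
    simpa using h0
  have h2 : (1 + ‖x‖) ^ k ≤ 2 ^ (k - 1) * (1 ^ k + ‖x‖ ^ k) :=
    add_pow_le zero_le_one (norm_nonneg x) k
  rw [norm_mul, norm_of_nonneg (exp_pos _).le]
  calc ‖f x‖ * exp (-‖x‖ ^ 2)
      ≤ C * (2 ^ (k - 1) * (1 ^ k + ‖x‖ ^ k)) * exp (-‖x‖ ^ 2) := by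
        gcongr
        exact h1.trans (by gcongr)
    _ = _ := by rw [one_pow, pow_zero]; ring

theorem gaussianMoment_const_mul (c : ℝ) (f : E → ℝ) :
    gaussianMoment (fun x ↦ c * f x) = c * gaussianMoment f := by
  simp only [gaussianMoment, mul_assoc]
  exact integral_const_mul _ _

section Linearity

variable [Nontrivial E] {f g : E → ℝ}

theorem gaussianMoment_add (hf : f.HasTemperateGrowth) (hg : g.HasTemperateGrowth) :
    gaussianMoment (fun x ↦ f x + g x) = gaussianMoment f + gaussianMoment g := by
  simp only [gaussianMoment, add_mul]
  exact integral_add hf.integrable_mul_exp_neg_norm_sq hg.integrable_mul_exp_neg_norm_sq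

theorem gaussianMoment_sum {ι : Type*} {s : Finset ι} {f : ι → E → ℝ}
    (hf : ∀ i ∈ s, (f i).HasTemperateGrowth) :
    gaussianMoment (fun x ↦ ∑ i ∈ s, f i x) = ∑ i ∈ s, gaussianMoment (f i) := by
  simp only [gaussianMoment, Finset.sum_mul]
  exact integral_finsetSum _ fun i hi ↦ (hf i hi).integrable_mul_exp_neg_norm_sq

end Linearity

theorem gaussianMoment_one :
    gaussianMoment (fun _ : E ↦ 1) = π ^ ((finrank ℝ E : ℝ) / 2) := by
  simpa [gaussianMoment] using GaussianFourier.integral_rexp_neg_mul_sq_norm (V := E) one_pos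

/-- Gaussian integration by parts in the direction `v`. -/
theorem gaussianMoment_inner_mul [Nontrivial E] {f f' : E → ℝ} {v : E}
    (hf : f.HasTemperateGrowth) (hf' : f'.HasTemperateGrowth)
    (hderiv : ∀ x, HasLineDerivAt ℝ f (f' x) x v) :
    gaussianMoment (fun x ↦ ⟪x, v⟫ * f x) = 1 / 2 * gaussianMoment f' := by
  have hx : Function.HasTemperateGrowth (fun x : E ↦ f x * (-2 * ⟪x, v⟫)) := by fun_prop
  have h := integral_bilinear_hasLineDerivAt_right_eq_neg_left_of_integrable
    (μ := (volume : Measure E)) (B := ContinuousLinearMap.mul ℝ ℝ) (v := v)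
    (f := f) (f' := f') (g := fun x ↦ exp (-‖x‖ ^ 2))
    (g' := fun x ↦ -2 * ⟪x, v⟫ * exp (-‖x‖ ^ 2))
    hf'.integrable_mul_exp_neg_norm_sq
    (by simpa [mul_assoc] using hx.integrable_mul_exp_neg_norm_sq)
    hf.integrable_mul_exp_neg_norm_sq
    (fun x _ ↦ hderiv x) (fun x _ ↦ hasLineDerivAt_exp_neg_norm_sq x v)
  have h2 : gaussianMoment (fun x ↦ -2 * (⟪x, v⟫ * f x)) = - gaussianMoment f' := by
    simp only [gaussianMoment, ContinuousLinearMap.mul_apply'] at h ⊢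
    rw [← h]
    congr 1
    ext x
    ring
  rw [gaussianMoment_const_mul] at h2
  linarith

section SymmetricOperator

variable [Nontrivial E] {A : E →L[ℝ] E}

theorem gaussianMoment_inner_mul_inner_apply (v : E) :
    gaussianMoment (fun x ↦ ⟪x, v⟫ * ⟪A x, v⟫) =
      1 / 2 * ⟪A v, v⟫ * gaussianMoment (fun _ : E ↦ 1) := by
  rw [gaussianMoment_inner_mul (hasTemperateGrowth_inner_apply A v) (.const _)
    (hasLineDerivAt_inner_apply A v v)]
  simpa [mul_assoc] using gaussianMoment_const_mul ⟪A v, v⟫ (fun _ : E ↦ 1)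

theorem gaussianMoment_inner_sq (v : E) :
    gaussianMoment (fun x : E ↦ ⟪x, v⟫ ^ 2) =
      1 / 2 * ‖v‖ ^ 2 * gaussianMoment (fun _ : E ↦ 1) := by
  simpa [sq] using gaussianMoment_inner_mul_inner_apply (A := .id ℝ E) v

theorem gaussianMoment_quadratic {ι : Type*} [Fintype ι] (b : OrthonormalBasis ι ℝ E) :
    gaussianMoment (fun x ↦ ⟪x, A x⟫) =
      1 / 2 * (∑ i, ⟪A (b i), b i⟫) * gaussianMoment (fun _ : E ↦ 1) := by
  have h2 := hasTemperateGrowth_inner_apply A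
  simp only [quadratic_eq_sum b]
  rw [gaussianMoment_sum fun i _ ↦ by fun_prop]
  simp only [gaussianMoment_inner_mul_inner_apply, Finset.mul_sum, Finset.sum_mul]

theorem gaussianMoment_inner_mul_inner_apply_mul_quadratic
    (hA : (A : E →ₗ[ℝ] E).IsSymmetric) {ι : Type*} [Fintype ι] (b : OrthonormalBasis ι ℝ E)
    (v : E) :
    gaussianMoment (fun x ↦ ⟪x, v⟫ * (⟪A x, v⟫ * ⟪x, A x⟫)) =
      (1 / 4 * ⟪A v, v⟫ * ∑ i, ⟪A (b i), b i⟫ + 1 / 2 * ‖A v‖ ^ 2) *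
        gaussianMoment (fun _ : E ↦ 1) := by
  have h2 := hasTemperateGrowth_inner_apply A
  have h3 := hasTemperateGrowth_quadratic A
  rw [gaussianMoment_inner_mul
    (f' := fun x ↦ ⟪A v, v⟫ * ⟪x, A x⟫ + 2 * ⟪x, A v⟫ ^ 2) (by fun_prop) (by fun_prop) fun x ↦ ?_]
  · rw [gaussianMoment_add (by fun_prop) (by fun_prop), gaussianMoment_const_mul,
      gaussianMoment_const_mul, gaussianMoment_quadratic b, gaussianMoment_inner_sq]
    ring
  · have h := (hasLineDerivAt_inner_apply A v v x).mul_real (hasLineDerivAt_quadratic hA v x)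
    have hs : ⟪A x, v⟫ = ⟪x, A v⟫ := hA x v
    convert h using 1
    rw [hs]
    ring

theorem gaussianMoment_quadratic_sq (hA : (A : E →ₗ[ℝ] E).IsSymmetric)
    {ι : Type*} [Fintype ι] (b : OrthonormalBasis ι ℝ E) :
    gaussianMoment (fun x ↦ ⟪x, A x⟫ ^ 2) =
      (1 / 4 * (∑ i, ⟪A (b i), b i⟫) ^ 2 + 1 / 2 * ∑ i, ‖A (b i)‖ ^ 2) *
        gaussianMoment (fun _ : E ↦ 1) := by
  have h2 := hasTemperateGrowth_inner_apply A
  have h3 := hasTemperateGrowth_quadratic A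
  have h (x : E) : ⟪x, A x⟫ ^ 2 = ∑ i, ⟪x, b i⟫ * (⟪A x, b i⟫ * ⟪x, A x⟫) := by
    rw [sq]
    nth_rw 1 [quadratic_eq_sum b]
    simp only [Finset.sum_mul, mul_assoc]
  simp only [h]
  rw [gaussianMoment_sum fun i _ ↦ by fun_prop]
  simp only [gaussianMoment_inner_mul_inner_apply_mul_quadratic hA b]
  rw [← Finset.sum_mul, Finset.sum_add_distrib, ← Finset.sum_mul, ← Finset.mul_sum,
    ← Finset.mul_sum]
  ring

theorem gaussianMoment_inner_sq_mul_quadratic_sq (hA : (A : E →ₗ[ℝ] E).IsSymmetric)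
    {ι : Type*} [Fintype ι] (b : OrthonormalBasis ι ℝ E) {v : E} (hv : ‖v‖ = 1) :
    gaussianMoment (fun x ↦ ⟪x, v⟫ ^ 2 * ⟪x, A x⟫ ^ 2) =
      1 / 8 * ((∑ i, ⟪A (b i), b i⟫) ^ 2 + 2 * ∑ i, ‖A (b i)‖ ^ 2 +
          4 * ⟪A v, v⟫ * ∑ i, ⟪A (b i), b i⟫ + 8 * ‖A v‖ ^ 2) *
        gaussianMoment (fun _ : E ↦ 1) := by
  have h2 := hasTemperateGrowth_inner_apply A
  have h3 := hasTemperateGrowth_quadratic A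
  have h (x : E) : ⟪x, v⟫ ^ 2 * ⟪x, A x⟫ ^ 2 = ⟪x, v⟫ * (⟪x, v⟫ * (⟪x, A x⟫ * ⟪x, A x⟫)) := by ring
  simp only [h]
  rw [gaussianMoment_inner_mul
    (f' := fun x ↦ ⟪x, A x⟫ ^ 2 + 4 * (⟪x, v⟫ * (⟪A x, v⟫ * ⟪x, A x⟫)))
    (by fun_prop) (by fun_prop) fun x ↦ ?_]
  · rw [gaussianMoment_add (by fun_prop) (by fun_prop), gaussianMoment_const_mul,
      gaussianMoment_quadratic_sq hA b, gaussianMoment_inner_mul_inner_apply_mul_quadratic hA b]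
    ring
  · have hq := hasLineDerivAt_quadratic hA v x
    have hv2 : ⟪v, v⟫ = 1 := by simp [hv]
    have h : HasLineDerivAt ℝ (fun x ↦ ⟪x, v⟫ * (⟪x, A x⟫ * ⟪x, A x⟫))
        (⟪v, v⟫ * (⟪x, A x⟫ * ⟪x, A x⟫) +
          ⟪x, v⟫ * (2 * ⟪A x, v⟫ * ⟪x, A x⟫ + ⟪x, A x⟫ * (2 * ⟪A x, v⟫))) x v :=
      (hasLineDerivAt_inner_apply (.id ℝ E) v v x).mul_real (hq.mul_real hq)
    convert h using 1
    rw [hv2]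
    ring

end SymmetricOperator

/-- The spherical integral of a homogeneous function of degree `k`, as a Gaussian moment. -/
theorem integral_toSphere_mul_Gamma [Nontrivial E] {f : E → ℝ} {k : ℕ}
    (hf : ∀ (r : ℝ) (x : E), f (r • x) = r ^ k * f x) :
    (∫ θ : sphere (0 : E) 1, f θ ∂(volume : Measure E).toSphere) *
      Gamma (((finrank ℝ E : ℝ) + k) / 2) = 2 * gaussianMoment f := by
  have hd : 0 < finrank ℝ E := finrank_pos
  have hradial : ∫ r : Ioi (0 : ℝ), (r : ℝ) ^ k * exp (-(r : ℝ) ^ 2)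
      ∂.volumeIoiPow (finrank ℝ E - 1) = 1 / 2 * Gamma (((finrank ℝ E : ℝ) + k) / 2) := by
    simp only [Measure.volumeIoiPow, ENNReal.ofReal]
    rw [integral_withDensity_eq_integral_smul
        ((measurable_subtype_coe.pow_const _).real_toNNReal),
      integral_subtype_comap measurableSet_Ioi
        fun a : ℝ ↦ Real.toNNReal (a ^ (finrank ℝ E - 1)) • (a ^ k * exp (-a ^ 2))]
    have h := integral_rpow_mul_exp_neg_rpow two_pos
      (q := ((finrank ℝ E - 1 + k : ℕ) : ℝ))
      (by linarith [Nat.cast_nonneg (α := ℝ) (finrank ℝ E - 1 + k)])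
    have hcast : ((finrank ℝ E - 1 + k : ℕ) : ℝ) + 1 = finrank ℝ E + k := by
      rw [Nat.cast_add, Nat.cast_pred hd]
      ring
    rw [hcast] at h
    rw [← h]
    refine setIntegral_congr_fun measurableSet_Ioi fun r hr ↦ ?_
    simp only [NNReal.smul_def, coe_toNNReal _ (pow_nonneg (le_of_lt hr) _), smul_eq_mul,
      rpow_natCast, rpow_two, pow_add]
    ring
  have hpolar : gaussianMoment f =
      (∫ θ : sphere (0 : E) 1, f θ ∂(volume : Measure E).toSphere) *
        ∫ r : Ioi (0 : ℝ), (r : ℝ) ^ k * exp (-(r : ℝ) ^ 2)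
          ∂.volumeIoiPow (finrank ℝ E - 1) := by
    have hcomp := (volume : Measure E).measurePreserving_homeomorphUnitSphereProd.integral_comp
      (Homeomorph.measurableEmbedding _)
      fun p : sphere (0 : E) 1 × Ioi (0 : ℝ) ↦ f p.1 * ((p.2 : ℝ) ^ k * exp (-(p.2 : ℝ) ^ 2))
    rw [integral_prod_mul (fun θ : sphere (0 : E) 1 ↦ f θ)
      fun r : Ioi (0 : ℝ) ↦ (r : ℝ) ^ k * exp (-(r : ℝ) ^ 2)] at hcomp
    have hpunctured := integral_subtype_comap (μ := (volume : Measure E))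
      (measurableSet_singleton 0).compl fun x : E ↦ f x * exp (-‖x‖ ^ 2)
    rw [restrict_compl_singleton] at hpunctured
    rw [← hcomp, gaussianMoment, ← hpunctured]
    apply integral_congr_ae
    filter_upwards with x
    have hx : ‖(x : E)‖ ≠ 0 := norm_ne_zero_iff.2 x.2
    simp [hf]
    field_simp
  rw [hpolar, hradial]
  ring

theorem integral_toSphere_inner_sq_mul_quadratic_sq_le [Nontrivial E] {A : E →L[ℝ] E}
    (hA : (A : E →ₗ[ℝ] E).IsSymmetric) {ι : Type*} [Fintype ι] (b : OrthonormalBasis ι ℝ E)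
    {v : E} (hv : ‖v‖ = 1) :
    ∫ θ : sphere (0 : E) 1, ⟪(θ : E), v⟫ ^ 2 * ⟪(θ : E), A θ⟫ ^ 2
        ∂(volume : Measure E).toSphere ≤
      π ^ ((finrank ℝ E : ℝ) / 2) / Gamma ((finrank ℝ E : ℝ) / 2 + 3) *
        (21 / 4 * ∑ i, ‖A (b i)‖ ^ 2 + 3 / 2 * (∑ i, ⟪A (b i), b i⟫) ^ 2) := by
  have hΓ : 0 < Gamma ((finrank ℝ E : ℝ) / 2 + 3) := Gamma_pos_of_pos (by positivity)
  have hint := integral_toSphere_mul_Gamma (E := E) (k := 6)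
    (f := fun x ↦ ⟪x, v⟫ ^ 2 * ⟪x, A x⟫ ^ 2) fun r x ↦ by
      simp only [map_smul, real_inner_smul_left, real_inner_smul_right]
      ring
  rw [gaussianMoment_inner_sq_mul_quadratic_sq hA b hv, gaussianMoment_one,
    show ((finrank ℝ E : ℝ) + (6 : ℕ)) / 2 = (finrank ℝ E : ℝ) / 2 + 3 by push_cast; ring] at hint
  have hQ := norm_apply_sq_le_sum_norm_apply_sq hA b hv
  have ha : ⟪A v, v⟫ ^ 2 ≤ ‖A v‖ ^ 2 := by
    rw [sq_le_sq, abs_norm]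
    simpa [hv] using abs_real_inner_le_norm (A v) v
  rw [eq_div_of_mul_eq hΓ.ne' hint, div_mul_eq_mul_div (π ^ _),
    div_le_div_iff_of_pos_right hΓ, ← mul_assoc, mul_comm]
  refine mul_le_mul_of_nonneg_left ?_ (by positivity)
  nlinarith [sq_nonneg (∑ i, ⟪A (b i), b i⟫ - 1 / 2 * ⟪A v, v⟫),
    sq_nonneg (∑ i, ⟪A (b i), b i⟫)]

end GaussianMoments

theorem stmt18 (d : ℕ) (hd : 1 ≤ d) (M : Matrix (Fin d) (Fin d) ℝ) (hM : M.IsSymm)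
    (y : Fin d → ℝ) (hy : ∑ i, y i ^ 2 = 1) :
    (∫ θ : sphere (0 : EuclideanSpace ℝ (Fin d)) 1,
        ((θ : EuclideanSpace ℝ (Fin d)) ⬝ᵥ y) ^ 2 *
          ((θ : EuclideanSpace ℝ (Fin d)) ⬝ᵥ (M *ᵥ (θ : EuclideanSpace ℝ (Fin d)))) ^ 2
        ∂((volume : Measure (EuclideanSpace ℝ (Fin d))).toSphere))
      ≤ (Real.pi ^ ((d : ℝ) / 2) / Real.Gamma ((d : ℝ) / 2 + 3)) *
          ((21 / 4) * (M * M).trace + (3 / 2) * M.trace ^ 2) := by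
  have : NeZero d := ⟨by lia⟩
  have hA : (toEuclideanCLM (𝕜 := ℝ) M : EuclideanSpace ℝ (Fin d) →ₗ[ℝ] _).IsSymmetric := by
    rw [coe_toEuclideanCLM_eq_toEuclideanLin, isSymmetric_toEuclideanLin_iff]
    rwa [IsHermitian, conjTranspose_eq_transpose_of_trivial]
  have hv : ‖WithLp.toLp 2 y‖ = 1 := by
    simp [EuclideanSpace.norm_eq, hy]
  have h := integral_toSphere_inner_sq_mul_quadratic_sq_le hA
    (EuclideanSpace.basisFun (Fin d) ℝ) hv
  have htr : ∑ i, inner ℝ (toEuclideanCLM (𝕜 := ℝ) M (EuclideanSpace.basisFun (Fin d) ℝ i))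
      (EuclideanSpace.basisFun (Fin d) ℝ i) = M.trace := by
    simp [trace, EuclideanSpace.inner_single_right]
  have htr_sq : ∑ i, ‖toEuclideanCLM (𝕜 := ℝ) M (EuclideanSpace.basisFun (Fin d) ℝ i)‖ ^ 2 =
      (M * M).trace := by
    simp only [trace, mul_apply, diag_apply, EuclideanSpace.norm_sq_eq]
    refine Finset.sum_congr rfl fun i _ ↦ Finset.sum_congr rfl fun j _ ↦ ?_
    simp [sq, hM.apply i j]
  rw [htr, htr_sq, finrank_euclideanSpace_fin] at h
  convert h using 6 with θ
  · simp [PiLp.inner_apply, dotProduct, mul_comm]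
  · simp [PiLp.inner_apply, dotProduct, mul_comm]
end
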